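/- Let n ≥ 2 and 0 < δ ≤ n. There exists a constant c depending only on n and δ such that ∫_{ℝⁿ} |u(x)| dH^{n−1}_∞ ≤ c ( ∫_{ℝⁿ} |∇u(x)|^{δ/n} dH^δ_∞ )^{n/δ} for every u ∈ C^∞_0(ℝⁿ). -/

import Mathlib

open MeasureTheory Metric Set Bornology
open scoped ENNReal NNReal

/-- The `δ`-dimensional Hausdorff content of a set `E ⊆ ℝⁿ`, defined as the infimum of
`∑ᵢ rᵢ^δ` over all countable coverings of `E` by open balls `B(xᵢ, rᵢ)`. -/
noncomputable def hContent (n : ℕ) (δ : ℝ) (E : Set (EuclideanSpace ℝ (Fin n))) : ℝ≥0∞ :=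
  ⨅ (x : ℕ → EuclideanSpace ℝ (Fin n)) (r : ℕ → ℝ≥0)
    (_ : E ⊆ ⋃ i, Metric.ball (x i) (r i)), ∑' i, (r i : ℝ≥0∞) ^ δ

/-- The `δ`-dimensional Hausdorff measure of `E ⊆ ℝⁿ`, obtained from coverings by open balls of
radii at most `ρ`, in the limit `ρ → 0⁺` (equivalently: the supremum over `ρ > 0`, since the
infima increase as `ρ` decreases). -/
noncomputable def hMeasure (n : ℕ) (δ : ℝ) (E : Set (EuclideanSpace ℝ (Fin n))) : ℝ≥0∞ :=
  ⨆ (ρ : ℝ≥0) (_ : 0 < ρ),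
    ⨅ (x : ℕ → EuclideanSpace ℝ (Fin n)) (r : ℕ → ℝ≥0)
      (_ : E ⊆ ⋃ i, Metric.ball (x i) (r i)) (_ : ∀ i, r i ≤ ρ), ∑' i, (r i : ℝ≥0∞) ^ δ

/-- The Choquet integral `∫_Ω f dH^δ_∞ = ∫₀^∞ H^δ_∞({x ∈ Ω : f x > t}) dt` of a
(nonnegative) real-valued function with respect to the Hausdorff content. -/
noncomputable def choquet (n : ℕ) (δ : ℝ) (Ω : Set (EuclideanSpace ℝ (Fin n)))
    (f : EuclideanSpace ℝ (Fin n) → ℝ) : ℝ≥0∞ :=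
  ∫⁻ t in Set.Ioi (0 : ℝ), hContent n δ {x ∈ Ω | t < f x}

/-- The Choquet integral of an `[0,∞]`-valued function with respect to the Hausdorff content. -/
noncomputable def echoquet (n : ℕ) (δ : ℝ) (Ω : Set (EuclideanSpace ℝ (Fin n)))
    (f : EuclideanSpace ℝ (Fin n) → ℝ≥0∞) : ℝ≥0∞ :=
  ∫⁻ t in Set.Ioi (0 : ℝ), hContent n δ {x ∈ Ω | ENNReal.ofReal t < f x}

/-- The centered fractional Hardy–Littlewood maximal function
`M_κ f (x) = sup_{r>0} r^{κ-n} ∫_{B(x,r)} |f|`. -/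
noncomputable def fracMaximal (n : ℕ) (κ : ℝ) (f : EuclideanSpace ℝ (Fin n) → ℝ)
    (x : EuclideanSpace ℝ (Fin n)) : ℝ≥0∞ :=
  ⨆ (r : ℝ) (_ : 0 < r),
    ENNReal.ofReal (r ^ (κ - n)) * ∫⁻ y in Metric.ball x r, ENNReal.ofReal |f y|

/-- The Riesz potential of order `1`: `I₁ f (x) = ∫_{ℝⁿ} |f y| / |x-y|^{n-1} dy`. -/
noncomputable def rieszPot (n : ℕ) (f : EuclideanSpace ℝ (Fin n) → ℝ)
    (x : EuclideanSpace ℝ (Fin n)) : ℝ≥0∞ :=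
  ∫⁻ y, ENNReal.ofReal |f y| / edist x y ^ ((n : ℝ) - 1)

/-- `Ω` is an `(α, β)`-John domain with John center `x₀`: every `x ∈ Ω` can be joined to `x₀`
by a rectifiable curve `γ : [0, L] → Ω` parametrized by arclength (hence `1`-Lipschitz) with
`γ 0 = x`, `γ L = x₀`, `L ≤ β` and `dist (γ t, ∂Ω) ≥ (α/β) t`. -/
def IsJohnDomainWithCenter (n : ℕ) (α β : ℝ) (Ω : Set (EuclideanSpace ℝ (Fin n)))
    (x₀ : EuclideanSpace ℝ (Fin n)) : Prop :=
  x₀ ∈ Ω ∧ ∀ x ∈ Ω, ∃ L : ℝ, 0 ≤ L ∧ L ≤ β ∧ ∃ γ : ℝ → EuclideanSpace ℝ (Fin n),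
    γ 0 = x ∧ γ L = x₀ ∧ (∀ t ∈ Set.Icc 0 L, γ t ∈ Ω) ∧
    LipschitzOnWith 1 γ (Set.Icc 0 L) ∧
    ∀ t ∈ Set.Icc 0 L, α / β * t ≤ Metric.infDist (γ t) (frontier Ω)

/-- `Ω` is an `(α, β)`-John domain. -/
def IsJohnDomain (n : ℕ) (α β : ℝ) (Ω : Set (EuclideanSpace ℝ (Fin n))) : Prop :=
  ∃ x₀, IsJohnDomainWithCenter n α β Ω x₀

section Segments

variable {E : Type*} [NormedAddCommGroup E] [NormedSpace ℝ E]

theorem enorm_sub_le_lintegral_fderiv_segment {w : E → ℝ} (hw : ContDiff ℝ 1 w) (x y : E) :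
    ‖w y - w x‖ₑ ≤ ∫⁻ t in Icc (0 : ℝ) 1, ‖fderiv ℝ w ((1 - t) • x + t • y)‖ₑ * ‖y - x‖ₑ := by
  have hγ : ∀ t : ℝ, HasDerivAt (fun t : ℝ => (1 - t) • x + t • y) (y - x) t := by
    intro t
    have h1 := ((hasDerivAt_id t).const_sub 1).smul_const x
    have h2 := (hasDerivAt_id t).smul_const y
    convert! h1.add h2 using 1
    simp [sub_eq_add_neg, add_comm]
  have hc : ContDiff ℝ 1 fun t : ℝ => w ((1 - t) • x + t • y) := by fun_prop
  have h := enorm_sub_le_lintegral_deriv_of_contDiffOn_Icc hc.contDiffOn zero_le_one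
  simp only [sub_self, zero_smul, one_smul, zero_add, sub_zero, add_zero] at h
  refine h.trans (lintegral_mono fun t => ?_)
  have hd := ((hw.differentiable one_ne_zero).differentiableAt.hasFDerivAt
    (x := (1 - t) • x + t • y)).comp_hasDerivAt t (hγ t)
  rw [show deriv (fun t : ℝ => w ((1 - t) • x + t • y)) t = _ from hd.deriv]
  exact ContinuousLinearMap.le_opENorm _ _

variable [MeasurableSpace E] [BorelSpace E] [FiniteDimensional ℝ E]
  (μ : Measure E) [μ.IsAddHaarMeasure]

theorem lintegral_comp_add_smul_le (F : E → ℝ≥0∞) (hF : Measurable F) (x : E) {t : ℝ}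
    (ht : 1 / 2 ≤ t) :
    ∫⁻ y, F (x + t • y) ∂μ ≤ 2 ^ Module.finrank ℝ E * ∫⁻ z, F z ∂μ := by
  have ht0 : 0 < t := by linarith
  have h1 : ∫⁻ y, F (x + t • y) ∂μ = ∫⁻ z, F (x + z) ∂(Measure.map (t • ·) μ) := by
    rw [lintegral_map (by fun_prop) (by fun_prop)]
  rw [h1, Measure.map_addHaar_smul μ ht0.ne', lintegral_smul_measure,
    lintegral_add_left_eq_self, smul_eq_mul]
  gcongr
  rw [abs_of_pos (by positivity), ← ENNReal.ofReal_ofNat, ← ENNReal.ofReal_pow (by norm_num)]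
  apply ENNReal.ofReal_le_ofReal
  rw [← inv_pow]
  gcongr
  rw [inv_le_comm₀ ht0 (by norm_num)]
  linarith

theorem measure_mul_le_lintegral_fderiv {B A D : Set E} (hB : MeasurableSet B) (hconv : Convex ℝ B)
    (hA : A ⊆ B) (hD : D ⊆ B) (hAm : MeasurableSet A) (hDm : MeasurableSet D) {d : ℝ≥0∞} (hd : ∀ x ∈ B, ∀ y ∈ B, ‖y - x‖ₑ ≤ d)
    {w : E → ℝ} (hw : ContDiff ℝ 1 w) (hwA : ∀ x ∈ A, 1 ≤ w x) (hwD : ∀ x ∈ D, w x ≤ 0) :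
    μ A * μ D ≤ d * 2 ^ Module.finrank ℝ E * μ B * ∫⁻ z in B, ‖fderiv ℝ w z‖ₑ ∂μ := by
  set G : E → ℝ≥0∞ := B.indicator fun z => ‖fderiv ℝ w z‖ₑ with hG
  have hGm : Measurable G :=
    ((hw.continuous_fderiv one_ne_zero).enorm.measurable).indicator hB
  have hGint : ∫⁻ z, G z ∂μ = ∫⁻ z in B, ‖fderiv ℝ w z‖ₑ ∂μ := lintegral_indicator hB _
  have hjm : Measurable fun p : (E × E) × ℝ => G ((1 - p.2) • p.1.1 + p.2 • p.1.2) :=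
    hGm.comp (by fun_prop)
  have hpt : ∀ x ∈ B, ∀ y ∈ B, A.indicator (fun _ => (1 : ℝ≥0∞)) x * D.indicator (fun _ => 1) y ≤
      d * ∫⁻ t in Icc (0 : ℝ) 1, G ((1 - t) • x + t • y) := by
    intro x hx y hy
    by_cases hxA : x ∈ A; swap
    · simp [hxA]
    by_cases hyD : y ∈ D; swap
    · simp [hyD]
    have h1 := enorm_sub_le_lintegral_fderiv_segment hw x y
    have h2 : (1 : ℝ≥0∞) ≤ ‖w y - w x‖ₑ := by
      rw [Real.enorm_eq_ofReal_abs, ENNReal.one_le_ofReal, abs_sub_comm]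
      exact le_trans (by linarith [hwA x hxA, hwD y hyD]) (le_abs_self _)
    simp only [indicator_of_mem hxA, indicator_of_mem hyD, mul_one]
    refine h2.trans (h1.trans ?_)
    rw [mul_comm, ← lintegral_mul_const _ (by fun_prop)]
    refine setLIntegral_mono' measurableSet_Icc fun t ht => ?_
    have hz : (1 - t) • x + t • y ∈ B :=
      hconv hx hy (by linarith [ht.2]) ht.1 (by ring)
    rw [hG, indicator_of_mem hz]
    gcongr
    exact hd x hx y hy
  have hslice : ∀ t ∈ Icc (0 : ℝ) 1, ∫⁻ x in B, ∫⁻ y in B, G ((1 - t) • x + t • y) ∂μ ∂μ ≤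
      2 ^ Module.finrank ℝ E * μ B * ∫⁻ z, G z ∂μ := by
    intro t ht
    have key : ∀ s : ℝ, 1 / 2 ≤ s →
        ∫⁻ x in B, ∫⁻ y in B, G ((1 - s) • x + s • y) ∂μ ∂μ ≤
          2 ^ Module.finrank ℝ E * μ B * ∫⁻ z, G z ∂μ := by
      intro s hs
      calc _ ≤ ∫⁻ x in B, 2 ^ Module.finrank ℝ E * ∫⁻ z, G z ∂μ ∂μ :=
            lintegral_mono fun x => (setLIntegral_le_lintegral _ _).trans
              (lintegral_comp_add_smul_le μ G hGm _ hs)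
        _ = _ := by rw [setLIntegral_const]; ring
    rcases le_total (1 / 2) t with h | h
    · exact key t h
    · rw [lintegral_lintegral_swap]
      · refine (lintegral_congr fun x => lintegral_congr fun y => ?_).trans_le
          (key (1 - t) (by linarith))
        rw [sub_sub_cancel, add_comm]
      · exact (hGm.comp (by fun_prop)).aemeasurable
  calc μ A * μ D
      = ∫⁻ x in B, ∫⁻ y in B, A.indicator (fun _ => (1 : ℝ≥0∞)) x *
          D.indicator (fun _ => 1) y ∂μ ∂μ := by
        rw [lintegral_lintegral_mul (measurable_const.indicator hAm).aemeasurable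
          (measurable_const.indicator hDm).aemeasurable, lintegral_indicator hAm,
          lintegral_indicator hDm, setLIntegral_const, setLIntegral_const,
          Measure.restrict_apply hAm, Measure.restrict_apply hDm, inter_eq_left.2 hA,
          inter_eq_left.2 hD, one_mul, one_mul]
    _ ≤ ∫⁻ x in B, ∫⁻ y in B, (d * ∫⁻ t in Icc (0 : ℝ) 1, G ((1 - t) • x + t • y)) ∂μ ∂μ :=
        setLIntegral_mono' hB fun x hx => setLIntegral_mono' hB fun y hy => hpt x hx y hy
    _ = d * ∫⁻ x in B, ∫⁻ y in B, (∫⁻ t in Icc (0 : ℝ) 1, G ((1 - t) • x + t • y)) ∂μ ∂μ := by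
        have hm : Measurable fun p : E × E => ∫⁻ t in Icc (0 : ℝ) 1,
            G ((1 - t) • p.1 + t • p.2) := hjm.lintegral_prod_right'
        rw [← lintegral_const_mul _ hm.lintegral_prod_right']
        refine lintegral_congr fun x => lintegral_const_mul _ (hm.comp measurable_prodMk_left)
    _ = d * ∫⁻ t in Icc (0 : ℝ) 1, (∫⁻ x in B, ∫⁻ y in B, G ((1 - t) • x + t • y) ∂μ ∂μ) := by
        have hm : Measurable fun p : E × ℝ => ∫⁻ y in B, G ((1 - p.2) • p.1 + p.2 • y) ∂μ :=
          Measurable.lintegral_prod_right' (f := fun q : (E × ℝ) × E =>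
            G ((1 - q.1.2) • q.1.1 + q.1.2 • q.2)) (hGm.comp (by fun_prop))
        congr 1
        calc _ = ∫⁻ x in B, (∫⁻ t in Icc (0 : ℝ) 1, ∫⁻ y in B, G ((1 - t) • x + t • y) ∂μ) ∂μ :=
              lintegral_congr fun x => lintegral_lintegral_swap
                (hGm.comp (by fun_prop)).aemeasurable
          _ = _ := lintegral_lintegral_swap hm.aemeasurable
    _ ≤ d * ∫⁻ t in Icc (0 : ℝ) 1, 2 ^ Module.finrank ℝ E * μ B * ∫⁻ z, G z ∂μ := by
        gcongr d * ?_
        exact setLIntegral_mono' measurableSet_Icc hslice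
    _ = _ := by
        rw [hGint, setLIntegral_const]; simp; ring

end Segments

theorem exists_smoothTransition_deriv_bound :
    ∃ K : ℝ, 0 < K ∧ (∀ t, |deriv Real.smoothTransition t| ≤ K) ∧
      ∀ t ∉ Icc (0 : ℝ) 1, deriv Real.smoothTransition t = 0 := by
  have hout : ∀ t ∉ Icc (0 : ℝ) 1, deriv Real.smoothTransition t = 0 := by
    intro t ht
    rw [mem_Icc, not_and_or, not_le, not_le] at ht
    rcases ht with h | h
    · have : Real.smoothTransition =ᶠ[nhds t] fun _ => 0 := by
        filter_upwards [gt_mem_nhds h] with z hz using Real.smoothTransition.zero_of_nonpos hz.le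
      rw [this.deriv_eq, deriv_const]
    · have : Real.smoothTransition =ᶠ[nhds t] fun _ => 1 := by
        filter_upwards [lt_mem_nhds h] with z hz using Real.smoothTransition.one_of_one_le hz.le
      rw [this.deriv_eq, deriv_const]
  have hcont : Continuous (deriv Real.smoothTransition) :=
    (Real.smoothTransition.contDiff (n := 1)).continuous_deriv le_rfl
  obtain ⟨K, hK⟩ := isCompact_Icc.exists_bound_of_continuousOn
    (hcont.continuousOn (s := Icc (0 : ℝ) 1))
  refine ⟨max K 1, by positivity, fun t => ?_, hout⟩
  by_cases ht : t ∈ Icc (0 : ℝ) 1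
  · exact (hK t ht).trans (le_max_left _ _)
  · rw [hout t ht, abs_zero]; positivity

/-- A smooth function of `|y|` which passes from `0` to `1` on the band `s ≤ |y| ≤ s + h`. -/
theorem exists_band_cutoff :
    ∃ K : ℝ, 0 < K ∧ ∀ s h : ℝ, 0 ≤ s → 0 < h → ∃ Φ : ℝ → ℝ, ContDiff ℝ 1 Φ ∧
      (∀ y, |y| ≤ s → Φ y ≤ 0) ∧ (∀ y, s + h ≤ |y| → 1 ≤ Φ y) ∧ (∀ y, |deriv Φ y| ≤ K / h) ∧
      ∀ y, |y| ∉ Icc s (s + h) → deriv Φ y = 0 := by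
  obtain ⟨K, hK, hb, hz⟩ := exists_smoothTransition_deriv_bound
  refine ⟨2 * K, by positivity, fun s h hs hh => ?_⟩
  have hw : 0 < (s + h) ^ 2 - s ^ 2 := by nlinarith
  set q : ℝ → ℝ := fun y => (y ^ 2 - s ^ 2) / ((s + h) ^ 2 - s ^ 2) with hq
  have hqd : ∀ y, HasDerivAt q (2 * y / ((s + h) ^ 2 - s ^ 2)) y := fun y => by
    simpa using ((hasDerivAt_pow 2 y).sub_const (s ^ 2)).div_const ((s + h) ^ 2 - s ^ 2)
  have hder : ∀ y, deriv (fun y => Real.smoothTransition (q y)) y =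
      deriv Real.smoothTransition (q y) * (2 * y / ((s + h) ^ 2 - s ^ 2)) := fun y =>
    (((Real.smoothTransition.contDiff (n := 1)).differentiable
      one_ne_zero).differentiableAt.hasDerivAt.comp y (hqd y)).deriv
  have hmem : ∀ y, q y ∈ Icc (0 : ℝ) 1 → |y| ∈ Icc s (s + h) := by
    rintro y ⟨h0, h1⟩
    rw [hq, le_div_iff₀ hw] at h0
    rw [hq, div_le_one hw] at h1
    constructor
    · exact abs_le_of_sq_le_sq' (by rw [sq_abs]; linarith) (abs_nonneg y) |>.2
    · exact abs_le_of_sq_le_sq (by linarith) (by linarith)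
  have hout : ∀ y, |y| ∉ Icc s (s + h) → deriv (fun y => Real.smoothTransition (q y)) y = 0 :=
    fun y hy => by rw [hder, hz _ fun h' => hy (hmem y h'), zero_mul]
  refine ⟨fun y => Real.smoothTransition (q y), ?_, fun y hy => ?_, fun y hy => ?_, fun y => ?_,
    hout⟩
  · exact Real.smoothTransition.contDiff.comp (by fun_prop)
  · refine (Real.smoothTransition.zero_of_nonpos ?_).le
    refine div_nonpos_of_nonpos_of_nonneg ?_ hw.le
    rw [← sq_abs y]
    nlinarith [abs_nonneg y]
  · refine (Real.smoothTransition.one_of_one_le ?_).ge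
    rw [hq, le_div_iff₀ hw, ← sq_abs y]
    nlinarith [abs_nonneg y]
  · by_cases hy : |y| ∈ Icc s (s + h)
    · rw [hder, abs_mul, show 2 * K / h = K * (2 / h) by ring, abs_div, abs_mul, abs_of_pos hw,
        abs_two]
      gcongr ?_ * ?_
      · exact hb _
      · rw [div_le_div_iff₀ hw hh]
        nlinarith [hy.2]
    · rw [hout y hy, abs_zero]; positivity

/-- For small `h`, a function has at least half of the mass of its
superlevel set `{|u| > s}` within a ball in `{|u| ≥ s + h}`. -/
theorem eventually_measure_superlevel_ge {E : Type*} [PseudoMetricSpace E]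
    [ProperSpace E] [MeasurableSpace E] (μ : Measure E) [IsFiniteMeasureOnCompacts μ]
    (u : E → ℝ) (x : E) (r s : ℝ)
    (hpos : μ (closedBall x r ∩ {z | s < |u z|}) ≠ 0) :
    ∀ᶠ k : ℕ in Filter.atTop, μ (closedBall x r ∩ {z | s < |u z|}) ≤
      2 * μ (closedBall x r ∩ {z | s + 1 / ((k : ℝ) + 1) ≤ |u z|}) := by
  have hmono : Monotone fun k : ℕ => closedBall x r ∩ {z | s + 1 / ((k : ℝ) + 1) ≤ |u z|} := by
    intro k l hkl
    refine inter_subset_inter_right _ fun z hz => ?_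
    refine le_trans ?_ hz.out
    have := Nat.one_div_le_one_div (α := ℝ) hkl
    linarith
  have hunion : ⋃ k : ℕ, closedBall x r ∩ {z | s + 1 / ((k : ℝ) + 1) ≤ |u z|} =
      closedBall x r ∩ {z | s < |u z|} := by
    rw [← inter_iUnion]
    congr 1
    ext z
    simp only [mem_iUnion, mem_ofPred_eq]
    constructor
    · rintro ⟨k, hk⟩
      have := Nat.one_div_pos_of_nat (α := ℝ) (n := k)
      linarith
    · intro hz
      obtain ⟨k, hk⟩ := exists_nat_one_div_lt (sub_pos.2 hz)
      exact ⟨k, by linarith⟩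
  have hlim := tendsto_measure_iUnion_atTop (μ := μ) hmono
  rw [hunion] at hlim
  have hfin : μ (closedBall x r ∩ {z | s < |u z|}) ≠ ∞ :=
    ((measure_mono inter_subset_left).trans_lt measure_closedBall_lt_top).ne
  filter_upwards [hlim.eventually_const_lt (ENNReal.half_lt_self hpos hfin)] with k hk
  rw [ENNReal.div_lt_iff (by simp) (by simp), mul_comm] at hk
  exact hk.le

section Boxing

variable {E : Type*} [NormedAddCommGroup E] [NormedSpace ℝ E] [MeasurableSpace E] [BorelSpace E]
  [FiniteDimensional ℝ E] (μ : Measure E) [μ.IsAddHaarMeasure]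

theorem exists_measure_mul_le_band :
    ∃ K : ℝ, 0 < K ∧ ∀ (u : E → ℝ), ContDiff ℝ 1 u → ∀ (x : E) (r s h : ℝ), 0 ≤ r → 0 ≤ s → 0 < h →
      μ (closedBall x r ∩ {z | s + h ≤ |u z|}) * μ (closedBall x r ∩ {z | |u z| ≤ s}) ≤
        ENNReal.ofReal (K * r) * μ (closedBall x r) * (ENNReal.ofReal h⁻¹ *
          ∫⁻ z in closedBall x r, {z | |u z| ∈ Icc s (s + h)}.indicator
            (fun z => ‖fderiv ℝ u z‖ₑ) z ∂μ) := by
  obtain ⟨K, hK, H⟩ := exists_band_cutoff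
  refine ⟨2 * 2 ^ Module.finrank ℝ E * K, by positivity, fun u hu x r s h hr hs hh => ?_⟩
  obtain ⟨Φ, hΦ, h0, h1, hb, hz⟩ := H s h hs hh
  have hcu : Continuous u := hu.continuous
  have hd : ∀ y ∈ closedBall x r, ∀ z ∈ closedBall x r, ‖z - y‖ₑ ≤ ENNReal.ofReal (2 * r) := by
    intro y hy z hz
    rw [← ofReal_norm]
    apply ENNReal.ofReal_le_ofReal
    rw [← dist_eq_norm]
    linarith [dist_triangle_right z y x, mem_closedBall.1 hy, mem_closedBall.1 hz]
  refine (measure_mul_le_lintegral_fderiv μ measurableSet_closedBall (convex_closedBall x r)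
    inter_subset_left inter_subset_left
    (measurableSet_closedBall.inter (measurableSet_le measurable_const hcu.abs.measurable))
    (measurableSet_closedBall.inter (measurableSet_le hcu.abs.measurable measurable_const))
    hd (w := fun z => Φ (u z)) (hΦ.comp hu) (fun z hz => h1 _ hz.2) (fun z hz => h0 _ hz.2)).trans ?_
  have hle : ∀ z, ‖fderiv ℝ (fun z => Φ (u z)) z‖ₑ ≤ ENNReal.ofReal (K * h⁻¹) *
      {z | |u z| ∈ Icc s (s + h)}.indicator (fun z => ‖fderiv ℝ u z‖ₑ) z := by
    intro z
    have hf : fderiv ℝ (fun z => Φ (u z)) z = deriv Φ (u z) • fderiv ℝ u z :=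
      ((hΦ.differentiable one_ne_zero).differentiableAt.hasDerivAt.comp_hasFDerivAt z
        (hu.differentiable one_ne_zero).differentiableAt.hasFDerivAt).fderiv
    rw [hf, enorm_smul]
    by_cases hm : |u z| ∈ Icc s (s + h)
    · rw [indicator_of_mem (show z ∈ {z | |u z| ∈ Icc s (s + h)} from hm)]
      gcongr
      rw [Real.enorm_eq_ofReal_abs, ← div_eq_mul_inv]
      exact ENNReal.ofReal_le_ofReal (hb _)
    · simp [hz _ hm]
  calc _ ≤ ENNReal.ofReal (2 * r) * 2 ^ Module.finrank ℝ E * μ (closedBall x r) *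
        (ENNReal.ofReal (K * h⁻¹) * ∫⁻ z in closedBall x r,
          {z | |u z| ∈ Icc s (s + h)}.indicator (fun z => ‖fderiv ℝ u z‖ₑ) z ∂μ) := by
        rw [← lintegral_const_mul' _ _ ENNReal.ofReal_ne_top]
        gcongr with z
        exact hle z
    _ = _ := by
        rw [show (2 : ℝ) * 2 ^ Module.finrank ℝ E * K * r = (2 * r) * 2 ^ Module.finrank ℝ E * K by
          ring, ENNReal.ofReal_mul hK.le,
          ENNReal.ofReal_mul (show 0 ≤ 2 * r * 2 ^ Module.finrank ℝ E by positivity),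
          ENNReal.ofReal_mul (show 0 ≤ 2 * r by positivity), ENNReal.ofReal_pow zero_le_two,
          ENNReal.ofReal_ofNat]
        ring

theorem exists_radius_bound [Nontrivial E] {M : ℝ≥0∞} (hM : M ≠ ∞) :
    ∃ R : ℝ, ∀ (x : E) (r : ℝ), 0 ≤ r → μ (closedBall x r) ≤ M → r ≤ R := by
  have hc0 : μ (ball (0 : E) 1) ≠ 0 := (measure_ball_pos μ _ one_pos).ne'
  refine ⟨max 1 (M / μ (ball 0 1)).toReal, fun x r hr h => ?_⟩
  rw [Measure.addHaar_closedBall μ x hr] at h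
  have h1 : ENNReal.ofReal (r ^ Module.finrank ℝ E) ≤ M / μ (ball 0 1) :=
    (ENNReal.le_div_iff_mul_le (Or.inl hc0) (Or.inl measure_ball_lt_top.ne)).2 h
  have h2 := (ENNReal.ofReal_le_iff_le_toReal (ENNReal.div_ne_top hM hc0)).1 h1
  rcases le_total r 1 with h3 | h3
  · exact h3.trans (le_max_left _ _)
  · exact (le_self_pow₀ h3 Module.finrank_pos.ne').trans (h2.trans (le_max_right _ _))

theorem exists_balanced_radius [Nontrivial E] {U : Set E} (hU : IsOpen U) (hfin : μ U ≠ ∞) {x : E}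
    (hx : x ∈ U) :
    ∃ r : ℝ, 0 < r ∧
      μ (closedBall x r) ≤ 2 ^ (Module.finrank ℝ E + 1) * μ (closedBall x r ∩ U) ∧
      μ (closedBall x r) ≤ 2 * μ (closedBall x r \ U) := by
  classical
  obtain ⟨ρ, hρ, hρU⟩ := nhds_basis_closedBall.mem_iff.1 (hU.mem_nhds hx)
  have hex : ∃ k : ℕ, 2 * μ (closedBall x (ρ * 2 ^ k) ∩ U) < μ (closedBall x (ρ * 2 ^ k)) := by
    by_contra! hcon
    obtain ⟨R, hR⟩ := exists_radius_bound μ (ENNReal.mul_ne_top (ENNReal.ofNat_ne_top (n := 2)) hfin)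
    obtain ⟨k, hk⟩ := pow_unbounded_of_one_lt (R / ρ) one_lt_two
    rw [div_lt_iff₀' hρ] at hk
    refine hk.not_ge (hR x _ (by positivity) ((hcon k).trans ?_))
    gcongr
    exact inter_subset_right
  obtain ⟨k, hk, hmin⟩ : ∃ k : ℕ, 2 * μ (closedBall x (ρ * 2 ^ (k + 1)) ∩ U) <
      μ (closedBall x (ρ * 2 ^ (k + 1))) ∧
      μ (closedBall x (ρ * 2 ^ k)) ≤ 2 * μ (closedBall x (ρ * 2 ^ k) ∩ U) := by
    have h0 : Nat.find hex ≠ 0 := by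
      intro h0
      have := Nat.find_spec hex
      rw [h0, pow_zero, mul_one, inter_eq_left.2 hρU] at this
      exact this.not_ge (le_mul_of_one_le_left' one_le_two)
    obtain ⟨k, hk⟩ := Nat.exists_eq_succ_of_ne_zero h0
    exact ⟨k, by simpa [hk] using Nat.find_spec hex,
      not_lt.1 (Nat.find_min hex (by lia))⟩
  have hr : 0 < ρ * 2 ^ k := by positivity
  have hscale : μ (closedBall x (ρ * 2 ^ (k + 1))) =
      2 ^ Module.finrank ℝ E * μ (closedBall x (ρ * 2 ^ k)) := by
    rw [Measure.addHaar_closedBall μ x (by positivity), Measure.addHaar_closedBall μ x hr.le,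
      show ρ * 2 ^ (k + 1) = 2 * (ρ * 2 ^ k) by ring, mul_pow, ENNReal.ofReal_mul (by positivity),
      ENNReal.ofReal_pow zero_le_two, ENNReal.ofReal_ofNat, mul_assoc]
  refine ⟨ρ * 2 ^ (k + 1), by positivity, ?_, ?_⟩
  · rw [hscale, pow_succ, mul_assoc]
    gcongr
    refine hmin.trans ?_
    gcongr
    · norm_num
    · lia
  · have hsplit := measure_inter_add_sdiff (μ := μ) (closedBall x (ρ * 2 ^ (k + 1)))
      hU.measurableSet
    have hne : μ (closedBall x (ρ * 2 ^ (k + 1))) ≠ ∞ := measure_closedBall_lt_top.ne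
    by_contra! hlt
    have := ENNReal.add_lt_add hk hlt
    rw [← mul_add, hsplit, two_mul] at this
    exact lt_irrefl _ this

theorem exists_radius_pow_le [Nontrivial E] :
    ∃ C : ℝ≥0∞, C ≠ ∞ ∧ ∀ (u : E → ℝ), ContDiff ℝ 1 u → ∀ (x : E) (r s h : ℝ),
      0 < r → 0 ≤ s → 0 < h →
      μ (closedBall x r) ≤ 2 ^ (Module.finrank ℝ E + 2) *
        μ (closedBall x r ∩ {z | s + h ≤ |u z|}) →
      μ (closedBall x r) ≤ 2 * μ (closedBall x r ∩ {z | |u z| ≤ s}) →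
      ENNReal.ofReal (r ^ (Module.finrank ℝ E - 1)) ≤ C * (ENNReal.ofReal h⁻¹ *
          ∫⁻ z in closedBall x r, {z | |u z| ∈ Icc s (s + h)}.indicator
            (fun z => ‖fderiv ℝ u z‖ₑ) z ∂μ) := by
  obtain ⟨K, hK, H⟩ := exists_measure_mul_le_band μ
  have hc0 : μ (ball (0 : E) 1) ≠ 0 := (measure_ball_pos μ _ one_pos).ne'
  have hct : μ (ball (0 : E) 1) ≠ ∞ := measure_ball_lt_top.ne
  refine ⟨2 ^ (Module.finrank ℝ E + 2) * 2 * ENNReal.ofReal K / μ (ball 0 1),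
    ENNReal.div_ne_top (by finiteness) hc0, fun u hu x r s h hr hs hh hA hD => ?_⟩
  have h1 := H u hu x r s h hr.le hs hh
  set X := ENNReal.ofReal h⁻¹ * ∫⁻ z in closedBall x r,
    {z | |u z| ∈ Icc s (s + h)}.indicator (fun z => ‖fderiv ℝ u z‖ₑ) z ∂μ with hX
  have hm0 : μ (closedBall x r) ≠ 0 := (measure_closedBall_pos μ _ hr).ne'
  have hmt : μ (closedBall x r) ≠ ∞ := measure_closedBall_lt_top.ne
  have hr0 : ENNReal.ofReal r ≠ 0 := by simpa using hr
  have h2 : μ (closedBall x r) * μ (closedBall x r) ≤ μ (closedBall x r) *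
      (ENNReal.ofReal r * (2 ^ (Module.finrank ℝ E + 2) * 2 * ENNReal.ofReal K * X)) := by
    refine (mul_le_mul' hA hD).trans ?_
    calc _ = 2 ^ (Module.finrank ℝ E + 2) * 2 * (μ (closedBall x r ∩ {z | s + h ≤ |u z|}) *
          μ (closedBall x r ∩ {z | |u z| ≤ s})) := by ring
      _ ≤ 2 ^ (Module.finrank ℝ E + 2) * 2 *
          (ENNReal.ofReal (K * r) * μ (closedBall x r) * X) := by gcongr
      _ = _ := by rw [ENNReal.ofReal_mul hK.le]; ring
  have h3 := (ENNReal.mul_le_mul_iff_right hm0 hmt).1 h2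
  have h4 : μ (closedBall x r) = ENNReal.ofReal r *
      (ENNReal.ofReal (r ^ (Module.finrank ℝ E - 1)) * μ (ball 0 1)) := by
    rw [Measure.addHaar_closedBall μ x hr.le, ← mul_assoc, ← ENNReal.ofReal_mul hr.le,
      mul_pow_sub_one Module.finrank_pos.ne']
  rw [h4] at h3
  have h5 := (ENNReal.mul_le_mul_iff_right hr0 ENNReal.ofReal_ne_top).1 h3
  rw [← ENNReal.le_div_iff_mul_le (Or.inl hc0) (Or.inl hct)] at h5
  refine h5.trans_eq ?_
  rw [div_eq_mul_inv, div_eq_mul_inv]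
  ring

end Boxing

theorem hContent_le_tsum {ι : Type*} [Countable ι] (n : ℕ) {δ : ℝ} (hδ : 0 < δ)
    {S : Set (EuclideanSpace ℝ (Fin n))} (x : ι → EuclideanSpace ℝ (Fin n)) (r : ι → ℝ≥0)
    (hS : S ⊆ ⋃ i, ball (x i) (r i)) : hContent n δ S ≤ ∑' i, (r i : ℝ≥0∞) ^ δ := by
  obtain ⟨e, he⟩ := exists_injective_nat ι
  have hsum : ∑' k, ((Function.extend e r 0 k : ℝ≥0) : ℝ≥0∞) ^ δ = ∑' i, (r i : ℝ≥0∞) ^ δ := by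
    rw [← he.tsum_eq]
    · simp only [he.extend_apply]
    · intro k hk
      by_contra hne
      refine hk ?_
      simp [Function.extend_apply' _ _ _ hne, hδ]
  rw [← hsum]
  refine iInf_le_of_le (Function.extend e x 0) (iInf_le_of_le (Function.extend e r 0)
    (iInf_le_of_le (hS.trans ?_) le_rfl))
  refine iUnion_subset fun i => ?_
  refine subset_trans ?_ (subset_iUnion _ (e i))
  rw [he.extend_apply, he.extend_apply]

/-- The energy of `u` in the band `s ≤ |u| ≤ s + h`, divided by the width of the band. -/
noncomputable def bandEnergy {n : ℕ} (u : EuclideanSpace ℝ (Fin n) → ℝ) (s h : ℝ) : ℝ≥0∞ :=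
  ENNReal.ofReal h⁻¹ * ∫⁻ z, {z | |u z| ∈ Icc s (s + h)}.indicator (fun z => ‖fderiv ℝ u z‖ₑ) z

/-- A boxing inequality: the content of `{|u| > s}` is bounded by a lower Minkowski-type
perimeter of it. -/
theorem exists_hContent_le_liminf_bandEnergy {n : ℕ} (hn : 2 ≤ n) :
    ∃ C : ℝ≥0∞, C ≠ ∞ ∧ ∀ u : EuclideanSpace ℝ (Fin n) → ℝ, ContDiff ℝ 1 u → HasCompactSupport u →
      ∀ s : ℝ, 0 < s → hContent n ((n : ℝ) - 1) {x | s < |u x|} ≤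
        Filter.liminf (fun k : ℕ => C * bandEnergy u s (1 / ((k : ℝ) + 1))) Filter.atTop := by
  have : Nonempty (Fin n) := ⟨⟨0, by lia⟩⟩
  have hfr : Module.finrank ℝ (EuclideanSpace ℝ (Fin n)) = n := finrank_euclideanSpace_fin
  obtain ⟨C, hC, H⟩ := exists_radius_pow_le (volume : Measure (EuclideanSpace ℝ (Fin n)))
  refine ⟨6 ^ (n - 1) * C, by finiteness, fun u hu hsupp s hs => ?_⟩
  set U : Set (EuclideanSpace ℝ (Fin n)) := {x | s < |u x|} with hUdef
  have hUo : IsOpen U := isOpen_lt continuous_const hu.continuous.abs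
  have hUfin : volume U ≠ ∞ := by
    refine ((measure_mono fun z hz => subset_tsupport u ?_).trans_lt
      (IsCompact.measure_lt_top hsupp)).ne
    rintro (h0 : u z = 0)
    rw [hUdef, mem_ofPred_eq, h0, abs_zero] at hz
    exact hz.not_gt hs
  have hrad : ∀ x : EuclideanSpace ℝ (Fin n), ∃ r : ℝ, x ∈ U → 0 < r ∧
      volume (closedBall x r) ≤ 2 ^ (n + 1) * volume (closedBall x r ∩ U) ∧
      volume (closedBall x r) ≤ 2 * volume (closedBall x r \ U) := by
    intro x
    by_cases hx : x ∈ U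
    · obtain ⟨r, hr⟩ := exists_balanced_radius volume hUo hUfin hx
      rw [hfr] at hr
      exact ⟨r, fun _ => hr⟩
    · exact ⟨0, fun h => absurd h hx⟩
  choose r hr using hrad
  obtain ⟨R, hR⟩ := exists_radius_bound (volume : Measure (EuclideanSpace ℝ (Fin n)))
    (M := 2 ^ (n + 1) * volume U) (by finiteness)
  obtain ⟨v, hvU, hdisj, hcov⟩ := Vitali.exists_disjoint_subfamily_covering_enlargement_closedBall U
    (fun x => x) r R (fun x hx => hR x _ (hr x hx).1.le
      ((hr x hx).2.1.trans (by gcongr; exact inter_subset_right))) 5 (by norm_num)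
  have hvc : v.Countable := hdisj.countable_of_nonempty_interior fun x hx =>
    ⟨x, ball_subset_interior_closedBall (mem_ball_self (hr x (hvU hx)).1)⟩
  have := hvc.to_subtype
  have hcov' : U ⊆ ⋃ i : v, ball (i : EuclideanSpace ℝ (Fin n)) (Real.toNNReal (6 * r i)) := by
    intro x hx
    obtain ⟨b, hb, hsub⟩ := hcov x hx
    have hb0 := (hr b (hvU hb)).1
    refine mem_iUnion.2 ⟨⟨b, hb⟩, ?_⟩
    have h5 := hsub (mem_closedBall_self (hr x hx).1.le)
    rw [mem_closedBall] at h5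
    rw [mem_ball, Real.coe_toNNReal _ (by positivity)]
    linarith
  have hn1 : (1 : ℝ) < n := by exact_mod_cast hn
  have hpow : ∀ i : v, ((Real.toNNReal (6 * r i) : ℝ≥0) : ℝ≥0∞) ^ ((n : ℝ) - 1) =
      6 ^ (n - 1) * ENNReal.ofReal (r i ^ (n - 1)) := by
    intro i
    have h0 := (hr i (hvU i.2)).1
    rw [show (n : ℝ) - 1 = ((n - 1 : ℕ) : ℝ) by rw [Nat.cast_pred (by lia)], ENNReal.rpow_natCast]
    change ENNReal.ofReal (6 * r i) ^ (n - 1) = _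
    rw [ENNReal.ofReal_mul (by norm_num), mul_pow, ENNReal.ofReal_pow h0.le, ENNReal.ofReal_ofNat]
  refine (hContent_le_tsum n (by linarith) _ _ hcov').trans ?_
  simp only [hpow]
  have hev : ∀ i : v, ∀ᶠ k : ℕ in Filter.atTop, ENNReal.ofReal (r i ^ (n - 1)) ≤
      C * (ENNReal.ofReal (1 / ((k : ℝ) + 1))⁻¹ * ∫⁻ z in closedBall (i : EuclideanSpace ℝ (Fin n))
        (r i), {z | |u z| ∈ Icc s (s + 1 / ((k : ℝ) + 1))}.indicator
          (fun z => ‖fderiv ℝ u z‖ₑ) z) := by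
    intro i
    obtain ⟨h0, h1, h2⟩ := hr i (hvU i.2)
    have hpos : volume (closedBall (i : EuclideanSpace ℝ (Fin n)) (r i) ∩ U) ≠ 0 := by
      intro hz
      rw [hz, mul_zero] at h1
      exact (measure_closedBall_pos volume _ h0).not_ge h1
    filter_upwards [eventually_measure_superlevel_ge volume u i (r i) s hpos] with k hk
    have := H u hu i (r i) s (1 / ((k : ℝ) + 1)) h0 hs.le (by positivity)
    rw [hfr] at this
    refine this ?_ ?_
    · refine h1.trans ((mul_le_mul_right hk _).trans_eq ?_)
      rw [← mul_assoc, ← pow_succ]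
    · convert h2 using 3
      ext z
      simp [hUdef]
  rw [ENNReal.tsum_eq_iSup_sum]
  refine iSup_le fun F => ?_
  refine Filter.le_liminf_of_le (by isBoundedDefault) ?_
  filter_upwards [(Filter.eventually_all_finset F).2 fun i _ => hev i] with k hk
  rw [← Finset.mul_sum, mul_assoc]
  gcongr
  refine (Finset.sum_le_sum hk).trans ?_
  rw [← Finset.mul_sum, ← Finset.mul_sum, bandEnergy]
  gcongr
  rw [← lintegral_biUnion_finset _ (fun i _ => measurableSet_closedBall)]
  · exact setLIntegral_le_lintegral _ _
  · intro i _ j _ hij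
    exact hdisj i.2 j.2 fun h => hij (Subtype.ext h)

theorem measurable_indicator_band {n : ℕ} {u : EuclideanSpace ℝ (Fin n) → ℝ} (hu : ContDiff ℝ 1 u)
    (h : ℝ) : Measurable fun p : ℝ × EuclideanSpace ℝ (Fin n) =>
      {z | |u z| ∈ Icc p.1 (p.1 + h)}.indicator (fun z => ‖fderiv ℝ u z‖ₑ) p.2 := by
  have hm : MeasurableSet {p : ℝ × EuclideanSpace ℝ (Fin n) | |u p.2| ∈ Icc p.1 (p.1 + h)} := by
    have hc : Continuous fun p : ℝ × EuclideanSpace ℝ (Fin n) => |u p.2| :=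
      (hu.continuous.comp continuous_snd).abs
    exact (measurableSet_le measurable_fst hc.measurable).inter
      (measurableSet_le hc.measurable (measurable_fst.add_const h))
  exact (((hu.continuous_fderiv one_ne_zero).enorm.measurable).comp measurable_snd).indicator hm

theorem measurable_bandEnergy {n : ℕ} {u : EuclideanSpace ℝ (Fin n) → ℝ} (hu : ContDiff ℝ 1 u)
    (h : ℝ) : Measurable fun s => bandEnergy u s h :=
  (measurable_indicator_band hu h).lintegral_prod_right'.const_mul _

theorem lintegral_bandEnergy_le {n : ℕ} {u : EuclideanSpace ℝ (Fin n) → ℝ} (hu : ContDiff ℝ 1 u)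
    {h : ℝ} (hh : 0 < h) : ∫⁻ s in Ioi (0 : ℝ), bandEnergy u s h ≤ ∫⁻ z, ‖fderiv ℝ u z‖ₑ := by
  have hslice : ∀ z, ∫⁻ s in Ioi (0 : ℝ),
      {z | |u z| ∈ Icc s (s + h)}.indicator (fun z => ‖fderiv ℝ u z‖ₑ) z ≤
        ENNReal.ofReal h * ‖fderiv ℝ u z‖ₑ := by
    intro z
    calc _ ≤ ∫⁻ s, {z | |u z| ∈ Icc s (s + h)}.indicator (fun z => ‖fderiv ℝ u z‖ₑ) z :=
          setLIntegral_le_lintegral _ _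
      _ = ∫⁻ s, (Icc (|u z| - h) |u z|).indicator (fun _ => ‖fderiv ℝ u z‖ₑ) s := by
          refine lintegral_congr fun s => ?_
          simp only [indicator, mem_ofPred_eq, mem_Icc, sub_le_iff_le_add, and_comm]
      _ = _ := by
          rw [lintegral_indicator_const measurableSet_Icc, Real.volume_Icc, sub_sub_cancel,
            mul_comm]
  unfold bandEnergy
  rw [lintegral_const_mul _ (measurable_indicator_band hu h).lintegral_prod_right',
    lintegral_lintegral_swap (measurable_indicator_band hu h).aemeasurable]
  calc _ ≤ ENNReal.ofReal h⁻¹ * ∫⁻ z, ENNReal.ofReal h * ‖fderiv ℝ u z‖ₑ := by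
        gcongr with z
        exact hslice z
    _ = _ := by
        rw [lintegral_const_mul' _ _ ENNReal.ofReal_ne_top, ← mul_assoc,
          ← ENNReal.ofReal_mul (by positivity), inv_mul_cancel₀ hh.ne', ENNReal.ofReal_one, one_mul]

theorem exists_choquet_le_lintegral_fderiv {n : ℕ} (hn : 2 ≤ n) :
    ∃ C : ℝ≥0∞, C ≠ ∞ ∧ ∀ u : EuclideanSpace ℝ (Fin n) → ℝ, ContDiff ℝ 1 u → HasCompactSupport u →
      choquet n ((n : ℝ) - 1) univ (fun x => |u x|) ≤ C * ∫⁻ z, ‖fderiv ℝ u z‖ₑ := by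
  obtain ⟨C, hC, H⟩ := exists_hContent_le_liminf_bandEnergy hn
  refine ⟨C, hC, fun u hu hsupp => ?_⟩
  calc choquet n ((n : ℝ) - 1) univ (fun x => |u x|)
      ≤ ∫⁻ s in Ioi (0 : ℝ),
          Filter.liminf (fun k : ℕ => C * bandEnergy u s (1 / ((k : ℝ) + 1))) Filter.atTop := by
        refine setLIntegral_mono' measurableSet_Ioi fun s hs => ?_
        simpa using H u hu hsupp s hs
    _ ≤ Filter.liminf (fun k : ℕ => ∫⁻ s in Ioi (0 : ℝ),
          C * bandEnergy u s (1 / ((k : ℝ) + 1))) Filter.atTop :=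
        lintegral_liminf_le fun k => (measurable_bandEnergy hu _).const_mul C
    _ ≤ Filter.liminf (fun _ : ℕ => C * ∫⁻ z, ‖fderiv ℝ u z‖ₑ) Filter.atTop := by
        refine Filter.liminf_le_liminf (Filter.Eventually.of_forall fun k => ?_)
        rw [lintegral_const_mul' _ _ hC]
        gcongr
        exact lintegral_bandEnergy_le hu (by positivity)
    _ = _ := Filter.liminf_const _

theorem tsum_rpow_le_rpow_tsum {ι : Type*} (a : ι → ℝ≥0∞) {p : ℝ} (hp : 1 ≤ p) :
    ∑' i, a i ^ p ≤ (∑' i, a i) ^ p := by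
  have hsplit : ∀ b : ℝ≥0∞, b ^ p = b * b ^ (p - 1) := fun b => by
    conv_lhs => rw [← add_sub_cancel 1 p,
      ENNReal.rpow_add_of_nonneg _ _ zero_le_one (sub_nonneg.2 hp), ENNReal.rpow_one]
  calc ∑' i, a i ^ p ≤ ∑' i, a i * (∑' i, a i) ^ (p - 1) := by
        refine ENNReal.tsum_le_tsum fun i => ?_
        rw [hsplit]
        gcongr
        exact ENNReal.le_tsum i
    _ = _ := by rw [ENNReal.tsum_mul_right, ← hsplit]

theorem volume_le_mul_hContent_rpow {n : ℕ} (hn : 1 ≤ n) {δ : ℝ} (hδ0 : 0 < δ) (hδn : δ ≤ n)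
    (S : Set (EuclideanSpace ℝ (Fin n))) :
    volume S ≤ volume (ball (0 : EuclideanSpace ℝ (Fin n)) 1) *
      hContent n δ S ^ ((n : ℝ) / δ) := by
  have : Nonempty (Fin n) := ⟨⟨0, by lia⟩⟩
  have hp : 0 < (n : ℝ) / δ := div_pos (by exact_mod_cast hn) hδ0
  have hc0 : volume (ball (0 : EuclideanSpace ℝ (Fin n)) 1) ≠ 0 :=
    (measure_ball_pos volume _ one_pos).ne'
  have hct : volume (ball (0 : EuclideanSpace ℝ (Fin n)) 1) ≠ ∞ := measure_ball_lt_top.ne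
  rw [mul_comm, ← ENNReal.div_le_iff hc0 hct, ← ENNReal.rpow_inv_le_iff hp]
  refine le_iInf fun x => le_iInf fun r => le_iInf fun hS => ?_
  rw [ENNReal.rpow_inv_le_iff hp, ENNReal.div_le_iff hc0 hct]
  calc volume S ≤ ∑' i, volume (ball (x i) (r i)) :=
        (measure_mono hS).trans (measure_iUnion_le _)
    _ = (∑' i, ((r i : ℝ≥0∞) ^ δ) ^ ((n : ℝ) / δ)) *
          volume (ball (0 : EuclideanSpace ℝ (Fin n)) 1) := by
        rw [← ENNReal.tsum_mul_right]
        refine tsum_congr fun i => ?_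
        rw [Measure.addHaar_ball _ _ (r i).coe_nonneg, finrank_euclideanSpace_fin,
          ENNReal.ofReal_pow (r i).coe_nonneg, ENNReal.ofReal_coe_nnreal, ← ENNReal.rpow_mul,
          mul_div_cancel₀ _ hδ0.ne', ENNReal.rpow_natCast]
    _ ≤ _ := by
        gcongr
        exact tsum_rpow_le_rpow_tsum _ ((one_le_div hδ0).2 hδn)

theorem hContent_mono (n : ℕ) (δ : ℝ) {S T : Set (EuclideanSpace ℝ (Fin n))} (h : S ⊆ T) :
    hContent n δ S ≤ hContent n δ T :=
  le_iInf fun x => le_iInf fun r => le_iInf fun hT =>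
    iInf_le_of_le x (iInf_le_of_le r (iInf_le_of_le (h.trans hT) le_rfl))

theorem mul_hContent_le_choquet (n : ℕ) (δ : ℝ) (g : EuclideanSpace ℝ (Fin n) → ℝ) (t : ℝ) :
    ENNReal.ofReal t * hContent n δ {x | t < g x} ≤ choquet n δ univ g := by
  calc ENNReal.ofReal t * hContent n δ {x | t < g x}
      = ∫⁻ _ in Ioc 0 t, hContent n δ {x | t < g x} := by
        rw [setLIntegral_const, Real.volume_Ioc, sub_zero, mul_comm]
    _ ≤ ∫⁻ s in Ioc 0 t, hContent n δ {x ∈ univ | s < g x} :=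
        setLIntegral_mono' measurableSet_Ioc fun s hs =>
          hContent_mono n δ fun x hx => ⟨mem_univ x, hs.2.trans_lt hx⟩
    _ ≤ choquet n δ univ g := lintegral_mono_set Ioc_subset_Ioi_self

theorem lintegral_rpow_le_choquet_rpow {n : ℕ} (hn : 1 ≤ n) {δ : ℝ} (hδ0 : 0 < δ) (hδn : δ ≤ n)
    {g : EuclideanSpace ℝ (Fin n) → ℝ} (hg0 : ∀ x, 0 ≤ g x) (hg : Measurable g) :
    ∫⁻ x, ENNReal.ofReal (g x ^ ((n : ℝ) / δ)) ≤ ENNReal.ofReal ((n : ℝ) / δ) *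
      volume (ball (0 : EuclideanSpace ℝ (Fin n)) 1) * choquet n δ univ g ^ ((n : ℝ) / δ) := by
  set p : ℝ := (n : ℝ) / δ with hpdef
  have hp1 : 1 ≤ p := (one_le_div hδ0).2 hδn
  have hp0 : 0 ≤ p - 1 := sub_nonneg.2 hp1
  have hsplit : ∀ b : ℝ≥0∞, b ^ p = b ^ (p - 1) * b := fun b => by
    conv_lhs => rw [← sub_add_cancel p 1,
      ENNReal.rpow_add_of_nonneg _ _ hp0 zero_le_one, ENNReal.rpow_one]
  have hmeas : Measurable fun t => hContent n δ {x | t < g x} :=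
    Antitone.measurable fun s t hst => hContent_mono n δ fun x hx => hst.trans_lt hx
  rw [lintegral_rpow_eq_lintegral_meas_lt_mul volume (Filter.Eventually.of_forall hg0)
    hg.aemeasurable (by linarith), mul_assoc]
  gcongr
  calc ∫⁻ t in Ioi 0, volume {a | t < g a} * ENNReal.ofReal (t ^ (p - 1))
      ≤ ∫⁻ t in Ioi 0, volume (ball (0 : EuclideanSpace ℝ (Fin n)) 1) *
          choquet n δ univ g ^ (p - 1) * hContent n δ {x | t < g x} := by
        refine setLIntegral_mono' measurableSet_Ioi fun t ht => ?_
        calc _ ≤ volume (ball (0 : EuclideanSpace ℝ (Fin n)) 1) * hContent n δ {x | t < g x} ^ p *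
              ENNReal.ofReal (t ^ (p - 1)) := by
              gcongr
              exact volume_le_mul_hContent_rpow hn hδ0 hδn _
          _ = volume (ball (0 : EuclideanSpace ℝ (Fin n)) 1) *
              (ENNReal.ofReal t * hContent n δ {x | t < g x}) ^ (p - 1) *
                hContent n δ {x | t < g x} := by
              rw [hsplit, ENNReal.mul_rpow_of_nonneg _ _ hp0,
                ENNReal.ofReal_rpow_of_pos (mem_Ioi.1 ht)]
              ring
          _ ≤ _ := by
              gcongr
              exact mul_hContent_le_choquet n δ g t
    _ = _ := by
        rw [lintegral_const_mul _ hmeas, hsplit, mul_assoc]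
        simp [choquet]

/-- Remark: Adams-type inequality combined with the comparison lemma. For
`0 < δ ≤ n` there is `c = c(n, δ)` such that
`∫_{ℝⁿ} |u| dH^{n-1}_∞ ≤ c (∫_{ℝⁿ} |∇u|^{δ/n} dH^δ_∞)^{n/δ}` for every `u ∈ C^∞₀(ℝⁿ)`. -/
theorem adams_inequality_content (n : ℕ) (hn : 2 ≤ n) (δ : ℝ)
    (hδ0 : 0 < δ) (hδn : δ ≤ (n : ℝ)) :
    ∃ c : ℝ≥0, 0 < c ∧
      ∀ u : EuclideanSpace ℝ (Fin n) → ℝ, ContDiff ℝ (⊤ : ℕ∞) u → HasCompactSupport u →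
        choquet n ((n : ℝ) - 1) Set.univ (fun x => |u x|)
          ≤ c * (choquet n δ Set.univ fun x => ‖fderiv ℝ u x‖ ^ (δ / n)) ^ ((n : ℝ) / δ) := by
  obtain ⟨C, hC, H⟩ := exists_choquet_le_lintegral_fderiv hn
  have hnpos : (0 : ℝ) < n := by exact_mod_cast (by lia : 0 < n)
  set D : ℝ≥0∞ := C * (ENNReal.ofReal ((n : ℝ) / δ) *
    volume (ball (0 : EuclideanSpace ℝ (Fin n)) 1)) with hD
  have hDt : D ≠ ∞ := ENNReal.mul_ne_top hC
    (ENNReal.mul_ne_top ENNReal.ofReal_ne_top measure_ball_lt_top.ne)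
  refine ⟨D.toNNReal + 1, by positivity, fun u hu hsupp => ?_⟩
  have hu1 : ContDiff ℝ 1 u := hu.of_le (by exact_mod_cast le_top)
  have hgm : Measurable fun x => ‖fderiv ℝ u x‖ ^ (δ / n) :=
    (hu1.continuous_fderiv one_ne_zero).norm.measurable.pow_const _
  have hg := lintegral_rpow_le_choquet_rpow (by lia) hδ0 hδn
    (fun x => Real.rpow_nonneg (norm_nonneg (fderiv ℝ u x)) _) hgm
  have hpow : ∀ x, ENNReal.ofReal ((‖fderiv ℝ u x‖ ^ (δ / n)) ^ ((n : ℝ) / δ)) =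
      ‖fderiv ℝ u x‖ₑ := fun x => by
    rw [← Real.rpow_mul (norm_nonneg _), div_mul_div_cancel₀ hnpos.ne', div_self hδ0.ne',
      Real.rpow_one, ofReal_norm]
  simp only [hpow] at hg
  refine (H u hu1 hsupp).trans ((mul_le_mul_right hg C).trans ?_)
  rw [← mul_assoc, ← hD]
  gcongr
  rw [ENNReal.coe_add, ENNReal.coe_toNNReal hDt]
  exact le_self_add
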